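/- For every odd integer p ≥ 3 there exists a continuous map F : ℝ → ℝ with F(x+1) = F(x) for all x ∈ ℝ (a lifting of a circle map of degree 0) such that: F has a periodic orbit P of period 2p+2 with max P − min P > 1, but F has no periodic point of exact period m for any odd integer m with 3 ≤ m ≤ p. In particular, the set of periods of F is not all of ℕ. -/

import Mathlib

/-- `x` is a periodic point of `F` of exact period `m`. -/
def HasExactPeriod (F : ℝ → ℝ) (m : ℕ) (x : ℝ) : Prop :=
  F^[m] x = x ∧ ∀ i, 1 ≤ i → i < m → F^[i] x ≠ x

/-- The profile on `[0,1]`. -/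
noncomputable def gProf (s x : ℝ) : ℝ := min (2 - 2 * x) (max (-2 * x) (s * (x - 1 / 2)))

/-- The lifting. -/
noncomputable def FLift (s x : ℝ) : ℝ := gProf s (Int.fract x)

lemma gProf_zero (s : ℝ) (hs : 0 ≤ s) : gProf s 0 = 0 := by
  unfold gProf
  rw [max_eq_left (by linarith), min_eq_right (by linarith)]; ring

lemma gProf_one (s : ℝ) (hs : 0 ≤ s) : gProf s 1 = 0 := by
  unfold gProf
  rw [max_eq_right (by linarith), min_eq_left (by linarith)]; ring

lemma FLift_cont (s : ℝ) (hs : 0 ≤ s) : Continuous (FLift s) := by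
  have h : Continuous (gProf s) := by unfold gProf; fun_prop
  exact ContinuousOn.comp_fract'' h.continuousOn (by rw [gProf_zero s hs, gProf_one s hs])

lemma gProf_symm (s t : ℝ) : gProf s (1 - t) = - gProf s t := by
  unfold gProf
  rcases le_total (-2 * t) (s * (t - 1 / 2)) with h1 | h1 <;>
  rcases le_total (-2 * (1 - t)) (s * ((1 - t) - 1 / 2)) with h2 | h2 <;>
  simp only [max_eq_left h1, max_eq_left h2, max_eq_right h1, max_eq_right h2, min_def] <;>
  split_ifs <;> linarith

lemma FLift_neg (s : ℝ) (hs : 0 ≤ s) (x : ℝ) : FLift s (-x) = - FLift s x := by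
  unfold FLift
  by_cases h : Int.fract x = 0
  · rw [Int.fract_neg_eq_zero.2 h, h, gProf_zero s hs]; simp
  · rw [Int.fract_neg h, gProf_symm]

lemma abstract_part (F : ℝ → ℝ) (d δ : ℝ) (p : ℕ) (hodd : Odd p)
    (hneg : ∀ x, F (-x) = - F x) (hb : ∀ x, |F x| ≤ d)
    (h1 : ∀ x, 0 < x → x < 1 / 2 → F x < 0)
    (h2 : ∀ x, |x| ≤ 1 / 2 → |F x| ≤ 2 * |x|)
    (h3 : ∀ x, 1 / 2 < |x| → |x| ≤ d → |F x| ≤ δ)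
    (h4 : ∀ x, |x| ≤ d / 2 → F x = -2 * x)
    (h5 : F d = δ) (h0 : F (1 / 2) = 0) (hd : 1 / 2 < d) (hd1 : d < 1)
    (hδ : δ * 2 ^ p = d) :
    (∃ x : ℝ, HasExactPeriod F (2 * p + 2) x ∧
        sSup (Set.range fun i : ℕ => F^[i] x) -
          sInf (Set.range fun i : ℕ => F^[i] x) > 1) ∧
      (∀ m : ℕ, 3 ≤ m → m ≤ p → Odd m → ¬∃ x : ℝ, HasExactPeriod F m x) := by
  have hδ0 : 0 < δ := by
    by_contra h
    have : δ * 2 ^ p ≤ 0 := mul_nonpos_of_nonpos_of_nonneg (not_lt.1 h) (by positivity)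
    linarith
  have hj : ∀ j, j < p → 2 ^ j * δ ≤ d / 2 := by
    intro j hj
    have : (2 : ℝ) ^ (j + 1) ≤ 2 ^ p := pow_le_pow_right₀ (by norm_num) hj
    rw [pow_succ] at this
    nlinarith
  have hF0 : F 0 = 0 := by rw [h4 0 (by simp; linarith)]; simp
  have hit0 : ∀ k, F^[k] 0 = 0 := fun k => Function.iterate_fixed hF0 k
  have hitneg : ∀ k x, F^[k] (-x) = - F^[k] x := by
    intro k
    induction k with
    | zero => intro x; rfl
    | succ k ih => intro x; rw [Function.iterate_succ_apply, Function.iterate_succ_apply, hneg, ih]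
  have hlin : ∀ j, j ≤ p → F^[j + 1] d = (-2) ^ j * δ := by
    intro j
    induction j with
    | zero => intro _; simp [h5]
    | succ j ih =>
      intro hjp
      rw [Function.iterate_succ_apply', ih (by omega), h4 _ _]
      · ring
      · rw [abs_mul, abs_pow, abs_neg, abs_two, abs_of_pos hδ0]
        exact hj j hjp
  have hsmall : ∀ j, j < p → |F^[j + 1] d| ≤ d / 2 := by
    intro j hjp
    rw [hlin j hjp.le, abs_mul, abs_pow, abs_neg, abs_two, abs_of_pos hδ0]
    exact hj j hjp
  have hmid : F^[p + 1] d = -d := by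
    rw [hlin p le_rfl, hodd.neg_pow]; linarith
  have hfull : F^[2 * p + 2] d = d := by
    rw [show 2 * p + 2 = (p + 1) + (p + 1) by ring, Function.iterate_add_apply, hmid, hitneg, hmid]
    ring
  refine ⟨⟨d, ⟨hfull, ?_⟩, ?_⟩, ?_⟩
  · intro i hi hi2 he
    rcases lt_trichotomy i (p + 1) with h | h | h
    · obtain ⟨j, rfl⟩ : ∃ j, i = j + 1 := ⟨i - 1, by omega⟩
      have := hsmall j (by omega)
      rw [he, abs_of_pos (by linarith)] at this
      linarith
    · rw [h, hmid] at he; linarith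
    · obtain ⟨j, rfl⟩ : ∃ j, i = (j + 1) + (p + 1) := ⟨i - (p + 2), by omega⟩
      have := hsmall j (by omega)
      rw [Function.iterate_add_apply, hmid, hitneg] at he
      rw [show F^[j + 1] d = -d by linarith, abs_neg, abs_of_pos (by linarith)] at this
      linarith
  · have hbd : ∀ i, |F^[i] d| ≤ d := by
      intro i
      cases i with
      | zero => simp [abs_of_pos (show 0 < d by linarith)]
      | succ i => rw [Function.iterate_succ_apply']; exact hb _
    have hS : d ≤ sSup (Set.range fun i : ℕ => F^[i] d) := by
      refine le_csSup ⟨d, ?_⟩ ⟨0, rfl⟩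
      rintro _ ⟨i, rfl⟩
      exact (abs_le.1 (hbd i)).2
    have hI : sInf (Set.range fun i : ℕ => F^[i] d) ≤ -d := by
      refine csInf_le ⟨-d, ?_⟩ ⟨p + 1, hmid⟩
      rintro _ ⟨i, rfl⟩
      exact (abs_le.1 (hbd i)).1
    linarith
  · rintro m hm3 hmp hmodd ⟨x, hx, hx'⟩
    have hper : ∀ i, F^[m] (F^[i] x) = F^[i] x := by
      intro i
      rw [← Function.iterate_add_apply, add_comm, Function.iterate_add_apply, hx]
    have hle : ∀ i, |F^[i] x| ≤ 1 / 2 := by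
      intro i
      by_contra hgt
      push Not at hgt
      have hy := hper i
      set y := F^[i] x
      have hyd : |y| ≤ d := by
        rw [← hy, show m = (m - 1) + 1 by omega, Function.iterate_succ_apply']; exact hb _
      have key : ∀ j, j < p → |F^[j + 1] y| ≤ 2 ^ j * δ := by
        intro j
        induction j with
        | zero => intro _; simpa using h3 y hgt hyd
        | succ j ih =>
          intro hjp
          have := ih (by omega)
          have h' := hj j (by omega)
          rw [Function.iterate_succ_apply']
          have h'' := h2 (F^[j + 1] y) (by linarith)
          rw [pow_succ]
          linarith
      have k1 := key (m - 1) (by omega)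
      have k2 := hj (m - 1) (by omega)
      rw [show m - 1 + 1 = m by omega, hy] at k1
      linarith
    have hne : ∀ i, F^[i] x ≠ 0 := by
      intro i hi
      have hx0 : x = 0 := by
        have e1 : F^[m * i] x = x := by
          rw [Function.iterate_mul]; exact Function.iterate_fixed hx i
        rw [← e1, show m * i = (m - 1) * i + i by
          obtain ⟨k, rfl⟩ : ∃ k, m = k + 1 := ⟨m - 1, by omega⟩
          simp; ring, Function.iterate_add_apply, hi, hit0]
      exact hx' 1 le_rfl (by omega) (by rw [hx0, hit0])
    have hstep : ∀ y, |y| ≤ 1 / 2 → y ≠ 0 → F y ≠ 0 → y * F y < 0 := by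
      intro y hy hy0 hFy
      rcases lt_or_gt_of_ne hy0 with h | h
      · rw [abs_of_neg h] at hy
        have hn : -y ≠ 1 / 2 := by
          intro e; apply hFy
          have := hneg y; rw [e, h0] at this; linarith
        have := h1 (-y) (by linarith) (lt_of_le_of_ne hy hn)
        rw [hneg] at this
        exact mul_neg_of_neg_of_pos h (by linarith)
      · rw [abs_of_pos h] at hy
        have hn : y ≠ 1 / 2 := by
          intro e; apply hFy; rw [e, h0]
        exact mul_neg_of_pos_of_neg h (h1 y h (lt_of_le_of_ne hy hn))
    have halt : ∀ i, 0 < (-1) ^ i * (x * F^[i] x) := by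
      intro i
      induction i with
      | zero => simpa using mul_self_pos.2 (hne 0)
      | succ i ih =>
        have hs := hstep (F^[i] x) (hle i) (hne i)
          (by rw [← Function.iterate_succ_apply' F]; exact hne (i + 1))
        rw [← Function.iterate_succ_apply' F] at hs
        have hsq : 0 < F^[i] x * F^[i] x := mul_self_pos.2 (hne i)
        by_contra hc
        have hc' : 0 ≤ (-1) ^ i * (x * F^[i + 1] x) := by
          rw [pow_succ] at hc; push Not at hc; linarith
        have q1 := mul_neg_of_pos_of_neg ih hs
        have q2 := mul_nonneg hc' hsq.le
        simp only [Nat.succ_eq_add_one] at q1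
        nlinarith
    have := halt m
    rw [hx, hmodd.neg_one_pow] at this
    nlinarith [mul_self_nonneg x]

lemma FLift_eq (s x : ℝ) (h0 : 0 ≤ x) (h1 : x < 1) : FLift s x = gProf s x := by
  unfold FLift; rw [Int.fract_eq_self.2 ⟨h0, h1⟩]

lemma gProf_lower (s d x : ℝ) (hs : 0 ≤ s) (hd : 0 ≤ d) (hsd : s * (1 - d) = 2 * d)
    (h0 : x ≤ 1) : -d ≤ gProf s x := by
  unfold gProf
  apply le_min
  · linarith
  · rcases le_total x (d / 2) with h | h
    · exact le_max_of_le_left (by linarith)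
    · apply le_max_of_le_right
      nlinarith [mul_le_mul_of_nonneg_left h hs]

lemma FLift_bound (s d x : ℝ) (hs : 0 ≤ s) (hd : 0 ≤ d) (hsd : s * (1 - d) = 2 * d) :
    |FLift s x| ≤ d := by
  have h : ∀ y, -d ≤ FLift s y := fun y =>
    gProf_lower s d _ hs hd hsd (Int.fract_lt_one y).le
  have h' := h (-x)
  rw [FLift_neg s hs] at h'
  exact abs_le.2 ⟨h x, by linarith⟩

lemma oddFun_abs {F : ℝ → ℝ} (hneg : ∀ x, F (-x) = - F x) (x : ℝ) : |F x| = |F (|x|)| := by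
  rcases abs_choice x with h | h <;> rw [h]
  rw [hneg, abs_neg]

lemma FLift_facts (N d s δ : ℝ) (p : ℕ) (hodd : Odd p) (hN : N = 2 ^ p) (hN1 : 1 ≤ N)
    (hd : d * (2 * N + 1) = N + 1) (hs : s * N = 2 * (N + 1)) (hδ : δ * N = d) :
    (∃ x : ℝ, HasExactPeriod (FLift s) (2 * p + 2) x ∧
        sSup (Set.range fun i : ℕ => (FLift s)^[i] x) -
          sInf (Set.range fun i : ℕ => (FLift s)^[i] x) > 1) ∧
      (∀ m : ℕ, 3 ≤ m → m ≤ p → Odd m → ¬∃ x : ℝ, HasExactPeriod (FLift s) m x) := by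
  have hs2 : 2 < s := by nlinarith
  have hd2 : 1 / 2 < d := by nlinarith
  have hd1 : d ≤ 2 / 3 := by nlinarith
  have hsd : s * (1 - d) = 2 * d := by
    have e : (1 - d) * (2 * N + 1) = N := by linarith
    have : (s * (1 - d)) * (2 * N + 1) = (2 * d) * (2 * N + 1) := by
      calc _ = s * ((1 - d) * (2 * N + 1)) := by ring
        _ = 2 * (N + 1) := by rw [e, hs]
        _ = _ := by rw [← hd]; ring
    exact mul_right_cancel₀ (by positivity) this
  have hsδ : s * (d - 1 / 2) = δ := by
    have e : (d - 1 / 2) * (2 * N + 1) = 1 / 2 := by linarith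
    have e2 : (s * (d - 1 / 2)) * (2 * N + 1) * N = δ * (2 * N + 1) * N := by
      calc _ = (s * N) * ((d - 1 / 2) * (2 * N + 1)) := by ring
        _ = N + 1 := by rw [e, hs]; ring
        _ = (δ * N) * (2 * N + 1) := by rw [hδ, hd]
        _ = _ := by ring
    exact mul_right_cancel₀ (by positivity) (mul_right_cancel₀ (by positivity) e2)
  have hneg := FLift_neg s (by linarith)
  have hval : ∀ x, 0 ≤ x → x ≤ d → FLift s x = max (-2 * x) (s * (x - 1 / 2)) := by
    intro x h0 h1
    rw [FLift_eq s x h0 (by linarith)]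
    unfold gProf
    apply min_eq_right
    apply max_le
    · linarith
    · nlinarith [mul_le_mul_of_nonneg_left h1 (show 0 ≤ s by linarith)]
  have hlo : ∀ x, 0 ≤ x → x ≤ d / 2 → FLift s x = -2 * x := by
    intro x h0 h1
    rw [hval x h0 (by linarith)]
    apply max_eq_left
    nlinarith [mul_le_mul_of_nonneg_left h1 (show 0 ≤ s by linarith)]
  have hhi : ∀ x, 1 / 2 ≤ x → x ≤ d → FLift s x = s * (x - 1 / 2) := by
    intro x h0 h1
    rw [hval x (by linarith) h1]
    apply max_eq_right
    nlinarith
  refine abstract_part (FLift s) d δ p hodd hneg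
    (fun x => FLift_bound s d x (by linarith) (by linarith) hsd) ?_ ?_ ?_ ?_ ?_ ?_ hd2
    (by linarith) (by rw [← hN, hδ])
  · intro x hx hx2
    rw [hval x hx.le (by linarith)]
    apply max_lt
    · linarith
    · nlinarith
  · intro x hx
    rw [oddFun_abs hneg, hval _ (abs_nonneg x) (by linarith)]
    have := abs_nonneg x
    rw [abs_le]
    constructor
    · exact le_max_of_le_left (by linarith)
    · apply max_le
      · linarith
      · nlinarith
  · intro x hx hx2
    rw [oddFun_abs hneg, hhi _ hx.le hx2, abs_of_nonneg (by nlinarith), ← hsδ]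
    nlinarith
  · intro x hx
    rcases le_total 0 x with h | h
    · rw [abs_of_nonneg h] at hx
      exact hlo x h hx
    · rw [abs_of_nonpos h] at hx
      have := hlo (-x) (by linarith) hx
      rw [hneg] at this
      linarith
  · rw [hhi d hd2.le le_rfl, hsδ]
  · rw [hhi _ le_rfl hd2.le]; ring

/-- For every odd `p ≥ 3` there is a lifting `F` of a circle map of degree `0` having a
periodic orbit of period `2p + 2` and diameter larger than `1`, but no periodic point of
exact odd period `m` with `3 ≤ m ≤ p`; in particular the set of periods of `F` is not all
of `ℕ`. -/
theorem exists_degree_zero_lifting_with_large_orbit_and_missing_periods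
    (p : ℕ) (hp : 3 ≤ p) (hodd : Odd p) :
    ∃ F : ℝ → ℝ, Continuous F ∧ (∀ x, F (x + 1) = F x) ∧
      (∃ x : ℝ, HasExactPeriod F (2 * p + 2) x ∧
        sSup (Set.range fun i : ℕ => F^[i] x) -
          sInf (Set.range fun i : ℕ => F^[i] x) > 1) ∧
      (∀ m : ℕ, 3 ≤ m → m ≤ p → Odd m → ¬∃ x : ℝ, HasExactPeriod F m x) ∧
      {m : ℕ | ∃ x : ℝ, HasExactPeriod F m x} ≠ {m : ℕ | 1 ≤ m} := by
  have hN : (1 : ℝ) ≤ 2 ^ p := one_le_pow₀ (by norm_num)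
  have hN0 : (0 : ℝ) < 2 ^ p := by positivity
  obtain ⟨hA, hB⟩ := FLift_facts (2 ^ p) ((2 ^ p + 1) / (2 * 2 ^ p + 1)) (2 * (2 ^ p + 1) / 2 ^ p)
    ((2 ^ p + 1) / (2 * 2 ^ p + 1) / 2 ^ p) p hodd rfl hN
    (div_mul_cancel₀ _ (by positivity)) (div_mul_cancel₀ _ (by positivity))
    (div_mul_cancel₀ _ (by positivity))
  refine ⟨FLift (2 * (2 ^ p + 1) / 2 ^ p), FLift_cont _ (by positivity), ?_, hA, hB, ?_⟩
  · intro x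
    unfold FLift
    rw [Int.fract_add_one]
  · intro h
    have h3 : (3 : ℕ) ∈ {m : ℕ | 1 ≤ m} := by simp
    rw [← h] at h3
    exact hB 3 le_rfl hp (by decide) h3
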